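/- Fix α > 1, δ ∈ (1/2,1), c > 0, p₀ > 0 and n ∈ ℕ. There exists a constant C > 0, depending only on α, δ, c, p₀ and n, such that for every f ∈ Z_{δ,c}, every p ≥ p₀, every b ∈ ℝ and every x ≥ 1: | ∫₁^∞ K_α(x/y; n)·⟨b + p f(y)⟩ dy/y | ≤ (C/(c·p·x^δ))·[ N₁(f) + (N₁(f)/Γ(f))² + N₂(f)/Γ(f) ], where ⟨t⟩ = t − ⌈t − 1/2⌉. -/

import Mathlib

open Real MeasureTheory Set Filter Topology Asymptotics

noncomputable section

/-- The kernel `K_α`. -/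
def Ka (α x : ℝ) : ℝ :=
  (Real.sin (2 * π / (1 + α)) / π) *
    (x / (1 + x ^ 2 - 2 * x * Real.cos (2 * π / (1 + α))))

/-- The Euler operator D = x d/dx. -/
def eulerD (f : ℝ → ℝ) : ℝ → ℝ := fun x => x * deriv f x

/-- The Euler operator D = x d/dx, with the derivative taken within a set. -/
def eulerDW (s : Set ℝ) (f : ℝ → ℝ) : ℝ → ℝ := fun x => x * derivWithin f s x

/-- K_α(x;n) = Dⁿ K_α(x). -/
def Kan (α : ℝ) (n : ℕ) : ℝ → ℝ := (eulerD)^[n] (Ka α)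

/-- ⟨t⟩ = t − ⌈t − 1/2⌉ ∈ (−1/2,1/2]. -/
def fract (t : ℝ) : ℝ := t - (⌈t - 1/2⌉ : ℝ)

/-- The class Z_{δ,c}: f ∈ C²([1,∞)), f(1) = 0, f′ > 0, Dⁿf ~ c δⁿ x^δ (n = 0,1,2). -/
def MemZclass (δ c : ℝ) (f : ℝ → ℝ) : Prop :=
  ContDiffOn ℝ 2 f (Set.Ici 1) ∧ f 1 = 0 ∧
  (∀ x : ℝ, 1 ≤ x → 0 < derivWithin f (Set.Ici 1) x) ∧
  ∀ n : ℕ, n ≤ 2 →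
    Tendsto (fun x : ℝ => (eulerDW (Set.Ici 1))^[n] f x / x ^ δ) atTop (𝓝 (c * δ ^ n))

/-- The right inverse φ_f of f (under the hypotheses, the set below is a singleton). -/
def phiF (f : ℝ → ℝ) (t : ℝ) : ℝ := sInf {x : ℝ | 1 ≤ x ∧ f x = t}

/-- The weight w(x). -/
def wght (x : ℝ) : ℝ := if x < 1 then 1 else x

/-- N₁(f) = ‖φ_f′‖⁺_{∞,1/δ−1}. -/
def N1c (δ : ℝ) (f : ℝ → ℝ) : ℝ :=
  sSup ((fun t => wght t ^ (-(1 / δ - 1)) * |deriv (phiF f) t|) '' Set.Ioi 0)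

/-- N₂(f) = ‖φ_f″‖⁺_{∞,1/δ−2}. -/
def N2c (δ : ℝ) (f : ℝ → ℝ) : ℝ :=
  sSup ((fun t => wght t ^ (-(1 / δ - 2)) * |deriv (deriv (phiF f)) t|) '' Set.Ioi 0)

/-- Γ(f) = inf_{t≥1} t^{−1/δ} φ_f(t). -/
def GammaC (δ : ℝ) (f : ℝ → ℝ) : ℝ :=
  sInf ((fun t => t ^ (-(1 / δ)) * phiF f t) '' Set.Ici 1)

/-- The denominator of `Ka α`. -/
def kerDen (α u : ℝ) : ℝ := 1 + u ^ 2 - 2 * u * Real.cos (2 * π / (1 + α))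

lemma abs_cos_lt_one {α : ℝ} (hα : 1 < α) : |Real.cos (2 * π / (1 + α))| < 1 := by
  have h1 : 0 < 2 * π / (1 + α) := by positivity
  have h2 : 2 * π / (1 + α) < π := by
    rw [div_lt_iff₀ (by linarith)]
    nlinarith [Real.pi_pos]
  have hs := Real.sin_pos_of_pos_of_lt_pi h1 h2
  rw [← sq_lt_one_iff_abs_lt_one]
  nlinarith [Real.sin_sq_add_cos_sq (2 * π / (1 + α))]

lemma kerDen_ge (α u : ℝ) :
    (1 - |Real.cos (2 * π / (1 + α))|) * (1 + u ^ 2) ≤ kerDen α u := by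
  unfold kerDen
  have h1 : |2 * u| ≤ 1 + u ^ 2 := by
    rw [abs_le]
    constructor <;> nlinarith [sq_nonneg (u + 1), sq_nonneg (u - 1)]
  have h2 : 2 * u * Real.cos (2 * π / (1 + α)) ≤
      (1 + u ^ 2) * |Real.cos (2 * π / (1 + α))| := by
    calc _ ≤ |2 * u * Real.cos (2 * π / (1 + α))| := le_abs_self _
      _ = |2 * u| * |Real.cos (2 * π / (1 + α))| := abs_mul _ _
      _ ≤ _ := by gcongr
  linarith

lemma kerDen_pos {α : ℝ} (hα : 1 < α) (u : ℝ) : 0 < kerDen α u := by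
  refine lt_of_lt_of_le ?_ (kerDen_ge α u)
  have := abs_cos_lt_one hα
  have h : 0 < 1 - |Real.cos (2 * π / (1 + α))| := by linarith
  positivity

lemma hasDerivAt_kerDen (α u : ℝ) :
    HasDerivAt (kerDen α) (2 * u - 2 * Real.cos (2 * π / (1 + α))) u := by
  have h1 := ((hasDerivAt_id u).pow 2).const_add 1
  have h2 := ((hasDerivAt_id u).const_mul 2).mul_const (Real.cos (2 * π / (1 + α)))
  refine (h1.sub h2).congr_deriv ?_
  simp

open Polynomial in
lemma hasDerivAt_mul_eval_div_kerDen_pow {α : ℝ} (hα : 1 < α) (R : ℝ[X]) (m : ℕ) (u : ℝ) :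
    HasDerivAt (fun v => v * R.eval v / kerDen α v ^ (m + 1))
      (((R + X * derivative R) * (1 + X ^ 2 - C (2 * Real.cos (2 * π / (1 + α))) * X)
        - C ((m : ℝ) + 1) * X * R * (C 2 * X - C (2 * Real.cos (2 * π / (1 + α))))).eval u
        / kerDen α u ^ (m + 2)) u := by
  have hQ := kerDen_pos hα u
  have h1 := (hasDerivAt_id u).mul (R.hasDerivAt u)
  have h2 := (hasDerivAt_kerDen α u).pow (m + 1)
  refine (h1.div h2 (pow_pos hQ (m + 1)).ne').congr_deriv ?_
  have hQe : (1 + X ^ 2 - C (2 * Real.cos (2 * π / (1 + α))) * X : ℝ[X]).eval u = kerDen α u := by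
    simp [kerDen]; ring
  rw [eval_sub, eval_mul (p := R + X * derivative R), hQe]
  simp only [id, eval_add, eval_mul, eval_X, eval_C, eval_sub, Pi.pow_apply, Pi.mul_apply]
  rw [div_eq_div_iff (by positivity) (by positivity)]
  push_cast
  ring

open Polynomial in
lemma exists_Kan_eq {α : ℝ} (hα : 1 < α) (n : ℕ) :
    ∃ R : ℝ[X], R.natDegree ≤ 2 * n ∧
      ∀ u, Kan α n u = u * R.eval u / kerDen α u ^ (n + 1) := by
  induction n with
  | zero =>
    refine ⟨C (Real.sin (2 * π / (1 + α)) / π), by simp, fun u => ?_⟩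
    simp [Kan, Ka, kerDen]
    ring
  | succ n ih =>
    obtain ⟨R, hR, h⟩ := ih
    refine ⟨(R + X * derivative R) * (1 + X ^ 2 - C (2 * Real.cos (2 * π / (1 + α))) * X)
        - C ((n : ℝ) + 1) * X * R * (C 2 * X - C (2 * Real.cos (2 * π / (1 + α)))), ?_,
      fun u => ?_⟩
    swap
    · rw [Kan, Function.iterate_succ_apply', eulerD]
      have h' : (eulerD)^[n] (Ka α) = fun u => u * R.eval u / kerDen α u ^ (n + 1) := funext h
      rw [h', (hasDerivAt_mul_eval_div_kerDen_pow hα R n u).deriv, ← mul_div_assoc]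
    · have h1 : (R + X * derivative R).natDegree ≤ 2 * n := by
        refine natDegree_add_le_of_degree_le hR ?_
        by_cases h0 : derivative R = 0
        · simp [h0]
        · rw [natDegree_X_mul h0]
          have hpos : R.natDegree ≠ 0 := fun hz => h0 (derivative_of_natDegree_zero hz)
          have := natDegree_derivative_lt hpos
          omega
      have h2 : (1 + X ^ 2 - C (2 * Real.cos (2 * π / (1 + α))) * X : ℝ[X]).natDegree ≤ 2 := by
        compute_degree
      have h3 : (C ((n : ℝ) + 1) * X * R).natDegree ≤ 1 + 2 * n := by
        refine natDegree_mul_le_of_le ?_ hR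
        compute_degree
      have h4 : (C 2 * X - C (2 * Real.cos (2 * π / (1 + α))) : ℝ[X]).natDegree ≤ 1 := by
        compute_degree
      refine natDegree_sub_le_of_le ?_ ?_ |>.trans (max_self _).le
      · exact (natDegree_mul_le_of_le h1 h2).trans (by omega)
      · exact (natDegree_mul_le_of_le h3 h4).trans (by omega)

lemma hasDerivAt_Kan {α : ℝ} (hα : 1 < α) (n : ℕ) {u : ℝ} (hu : u ≠ 0) :
    HasDerivAt (Kan α n) (Kan α (n + 1) u / u) u := by
  obtain ⟨R, -, h⟩ := exists_Kan_eq hα n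
  have h' : Kan α n = fun u => u * R.eval u / kerDen α u ^ (n + 1) := funext h
  have hd : DifferentiableAt ℝ (Kan α n) u := by
    rw [h']
    exact (hasDerivAt_mul_eval_div_kerDen_pow hα R n u).differentiableAt
  refine hd.hasDerivAt.congr_deriv ?_
  rw [show Kan α (n + 1) u = u * deriv (Kan α n) u by
    simp only [Kan, Function.iterate_succ_apply', eulerD]]
  field_simp

lemma continuous_Kan {α : ℝ} (hα : 1 < α) (n : ℕ) : Continuous (Kan α n) := by
  obtain ⟨R, -, h⟩ := exists_Kan_eq hα n
  rw [show Kan α n = fun u => u * R.eval u / kerDen α u ^ (n + 1) from funext h]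
  exact continuous_iff_continuousAt.2 fun u =>
    (hasDerivAt_mul_eval_div_kerDen_pow hα R n u).continuousAt

lemma pow_le_one_add_sq_pow {u : ℝ} (hu : 0 < u) {k n : ℕ} (hk : k ≤ 2 * n) :
    u ^ k ≤ (1 + u ^ 2) ^ n := by
  rcases le_total u 1 with h | h
  · calc u ^ k ≤ 1 := pow_le_one₀ hu.le h
      _ ≤ _ := one_le_pow₀ (by nlinarith)
  · calc u ^ k ≤ u ^ (2 * n) := pow_le_pow_right₀ h hk
      _ = (u ^ 2) ^ n := pow_mul _ _ _
      _ ≤ _ := by gcongr; linarith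

open Polynomial in
lemma exists_abs_eval_le (R : ℝ[X]) {n : ℕ} (hR : R.natDegree ≤ 2 * n) :
    ∃ A : ℝ, 0 < A ∧ ∀ u : ℝ, 0 < u → |R.eval u| ≤ A * (1 + u ^ 2) ^ n := by
  refine ⟨1 + ∑ i ∈ Finset.range (2 * n + 1), |R.coeff i|, ?_, fun u hu => ?_⟩
  · have : 0 ≤ ∑ i ∈ Finset.range (2 * n + 1), |R.coeff i| :=
      Finset.sum_nonneg fun _ _ => abs_nonneg _
    linarith
  · rw [eval_eq_sum_range' (Nat.lt_succ_of_le hR)]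
    calc _ ≤ ∑ i ∈ Finset.range (2 * n + 1), |R.coeff i * u ^ i| := Finset.abs_sum_le_sum_abs _ _
      _ ≤ ∑ i ∈ Finset.range (2 * n + 1), |R.coeff i| * (1 + u ^ 2) ^ n := by
        refine Finset.sum_le_sum fun i hi => ?_
        rw [abs_mul, abs_of_pos (pow_pos hu i)]
        have hi' : i ≤ 2 * n := by have := Finset.mem_range.1 hi; omega
        exact mul_le_mul_of_nonneg_left (pow_le_one_add_sq_pow hu hi') (abs_nonneg _)
      _ = (∑ i ∈ Finset.range (2 * n + 1), |R.coeff i|) * (1 + u ^ 2) ^ n := by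
        rw [Finset.sum_mul]
      _ ≤ _ := by
        have : 0 < (1 + u ^ 2) ^ n := by positivity
        nlinarith

lemma exists_abs_Kan_le {α : ℝ} (hα : 1 < α) (n : ℕ) :
    ∃ A : ℝ, 0 < A ∧ ∀ u : ℝ, 0 < u → |Kan α n u| ≤ A * min u (1 / u) := by
  obtain ⟨R, hR, h⟩ := exists_Kan_eq hα n
  obtain ⟨A, hA, hb⟩ := exists_abs_eval_le R hR
  set q := 1 - |Real.cos (2 * π / (1 + α))| with hq
  have hq0 : 0 < q := by have := abs_cos_lt_one hα; linarith
  refine ⟨A / q ^ (n + 1), by positivity, fun u hu => ?_⟩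
  have hQ := kerDen_pos hα u
  have key : |Kan α n u| ≤ A / q ^ (n + 1) * (u / (1 + u ^ 2)) := by
    rw [h, abs_div, abs_mul, abs_of_pos hu, abs_of_pos (pow_pos hQ _)]
    calc _ ≤ u * (A * (1 + u ^ 2) ^ n) / (q * (1 + u ^ 2)) ^ (n + 1) := by
          gcongr
          · exact hb u hu
          · exact kerDen_ge α u
      _ = _ := by rw [mul_pow]; field_simp; ring
  refine key.trans (mul_le_mul_of_nonneg_left (le_min ?_ ?_) (by positivity))
  · exact div_le_self hu.le (by nlinarith)
  · rw [div_le_div_iff₀ (by positivity) hu]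
    nlinarith

/-- A continuous periodic primitive of `fract`. -/
def fractPrim (s : ℝ) : ℝ := (s - round s) ^ 2 / 2

lemma continuous_fractPrim : Continuous fractPrim := by
  have h : fractPrim = fun s : ℝ => ‖(s : UnitAddCircle)‖ ^ 2 / 2 := by
    ext s
    rw [UnitAddCircle.norm_eq, sq_abs, fractPrim]
  rw [h]
  have : Continuous fun s : ℝ => (s : UnitAddCircle) := AddCircle.continuous_mk' 1
  fun_prop

lemma abs_fractPrim_le (s : ℝ) : |fractPrim s| ≤ 1 := by
  have h := abs_le.1 (abs_sub_round s)
  rw [fractPrim, abs_of_nonneg (by positivity)]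
  nlinarith

lemma hasDerivAt_fractPrim {s : ℝ} (hs : s - 1 / 2 ∉ Set.range ((↑) : ℤ → ℝ)) :
    HasDerivAt fractPrim (fract s) s := by
  set m : ℤ := ⌈s - 1 / 2⌉ with hm
  have h1 : s - 1 / 2 < m :=
    lt_of_le_of_ne (Int.le_ceil _) fun h => hs ⟨m, h.symm⟩
  have h2 : (m : ℝ) < s - 1 / 2 + 1 := Int.ceil_lt_add_one _
  have hev : fractPrim =ᶠ[𝓝 s] fun v => (v - m) ^ 2 / 2 := by
    filter_upwards [Ioo_mem_nhds (show (m : ℝ) - 1 / 2 < s by linarith)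
      (show s < (m : ℝ) + 1 / 2 by linarith)] with v hv
    have : round v = m := by
      rw [round_eq, Int.floor_eq_iff]
      constructor <;> linarith [hv.1, hv.2]
    rw [fractPrim, this]
  refine HasDerivAt.congr_of_eventuallyEq ?_ hev
  have h3 := (((hasDerivAt_id s).sub_const (m : ℝ)).pow 2).div_const 2
  refine h3.congr_deriv ?_
  rw [fract, ← hm]
  simp

/-- `f` vanishes at `1` and has first and second derivatives `f₁ > 0` and `f₂` on `[1, ∞)`. -/
structure HasPosDerivs (f f₁ f₂ : ℝ → ℝ) : Prop where
  map_one : f 1 = 0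
  cont : ContinuousOn f (Ici 1)
  cont₁ : ContinuousOn f₁ (Ici 1)
  cont₂ : ContinuousOn f₂ (Ici 1)
  deriv₁ : ∀ y, 1 < y → HasDerivAt f (f₁ y) y
  deriv₂ : ∀ y, 1 < y → HasDerivAt f₁ (f₂ y) y
  pos : ∀ y, 1 ≤ y → 0 < f₁ y

lemma HasPosDerivs.strictMonoOn {f f₁ f₂ : ℝ → ℝ} (h : HasPosDerivs f f₁ f₂) :
    StrictMonoOn f (Ici 1) := by
  refine strictMonoOn_of_deriv_pos (convex_Ici 1) h.cont fun y hy => ?_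
  rw [interior_Ici] at hy
  rw [(h.deriv₁ y hy).deriv]
  exact h.pos y (le_of_lt hy)

lemma HasPosDerivs.map_pos {f f₁ f₂ : ℝ → ℝ} (h : HasPosDerivs f f₁ f₂) {y : ℝ} (hy : 1 < y) :
    0 < f y := by
  rw [← h.map_one]
  exact h.strictMonoOn self_mem_Ici hy.le hy

lemma min_div_sq_le {δ x y t g : ℝ} (hδ : 0 < δ) (hδ' : δ < 1) (hx : 0 < x) (hg : 0 < g)
    (ht : 0 < t) (hy : g * t ^ (1 / δ) ≤ y) :
    min (x / y ^ 2) (1 / x) ≤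
      4 / x * ((x / g) ^ (1 - δ)) ^ 2 / ((x / g) ^ (1 - δ) + t ^ (1 / δ - 1)) ^ 2 := by
  set u := t ^ (1 / δ) with hu
  have hu0 : 0 < u := Real.rpow_pos_of_pos ht _
  have hs : t ^ (1 / δ - 1) = u ^ (1 - δ) := by
    rw [hu, ← Real.rpow_mul ht.le]
    congr 1
    field_simp
  rw [hs]
  set X := x / g with hX
  have hX0 : 0 < X := by positivity
  set S := X ^ (1 - δ) with hS
  set s := u ^ (1 - δ) with hs'
  have hS0 : 0 < S := Real.rpow_pos_of_pos hX0 _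
  have hs0 : 0 < s := Real.rpow_pos_of_pos hu0 _
  have hy0 : 0 < y := lt_of_lt_of_le (by positivity) hy
  rcases le_total u X with h | h
  · refine (min_le_right _ _).trans ?_
    have h1 : s ≤ S := Real.rpow_le_rpow hu0.le h (by linarith)
    calc 1 / x = 4 / x * S ^ 2 / (2 * S) ^ 2 := by field_simp; ring
      _ ≤ _ := by gcongr; linarith
  · refine (min_le_left _ _).trans ?_
    have h1 : S ≤ s := Real.rpow_le_rpow hX0.le h (by linarith)
    have h2 : x / y ≤ S / s := by
      calc x / y ≤ x / (g * u) := by gcongr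
        _ = X / u := by rw [hX]; field_simp
        _ = (X / u) ^ (1 : ℝ) := (Real.rpow_one _).symm
        _ ≤ (X / u) ^ (1 - δ) :=
          Real.rpow_le_rpow_of_exponent_ge (by positivity) ((div_le_one hu0).2 h) (by linarith)
        _ = S / s := Real.div_rpow hX0.le hu0.le _
    have h3 : S / s ≤ 2 * S / (S + s) := by
      rw [div_le_div_iff₀ hs0 (by positivity)]
      nlinarith
    calc x / y ^ 2 = 1 / x * (x / y) ^ 2 := by field_simp
      _ ≤ 1 / x * (2 * S / (S + s)) ^ 2 := by
        exact mul_le_mul_of_nonneg_left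
          (pow_le_pow_left₀ (by positivity) (h2.trans h3) 2) (by positivity)
      _ = _ := by rw [div_pow, mul_pow]; ring

lemma sq_div_le_rpow {δ N g t y z : ℝ} (hδ : 1 / 2 < δ) (hδ' : δ < 1) (hg : 0 < g)
    (hg1 : g ≤ 1) (ht : 0 < t) (hy1 : 1 ≤ y) (hy : g * t ^ (1 / δ) ≤ y) (hz : 0 ≤ z)
    (hzN : z ≤ N * wght t ^ (1 / δ - 1)) :
    z ^ 2 / y ≤ N ^ 2 / g * t ^ (1 / δ - 2) := by
  have hδ0 : 0 < δ := by linarith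
  unfold wght at hzN
  split_ifs at hzN with h
  · rw [Real.one_rpow, mul_one] at hzN
    have he : 1 / δ - 2 ≤ 0 := by
      rw [sub_nonpos, div_le_iff₀ hδ0]; linarith
    have h1 : 1 ≤ t ^ (1 / δ - 2) := Real.one_le_rpow_of_pos_of_le_one_of_nonpos ht h.le he
    calc z ^ 2 / y ≤ N ^ 2 / g := by
          have : z ^ 2 ≤ N ^ 2 := by gcongr
          exact div_le_div₀ (by positivity) this hg (hg1.trans hy1)
      _ ≤ _ := le_mul_of_one_le_right (by positivity) h1
  · have hp : 0 < t ^ (1 / δ) := Real.rpow_pos_of_pos ht _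
    calc z ^ 2 / y ≤ (N * t ^ (1 / δ - 1)) ^ 2 / (g * t ^ (1 / δ)) := by gcongr
      _ = N ^ 2 / g * ((t ^ (1 / δ - 1)) ^ 2 / t ^ (1 / δ)) := by
        rw [mul_pow, mul_div_mul_comm]
      _ = _ := by
        rw [← Real.rpow_natCast (t ^ (1 / δ - 1)), ← Real.rpow_mul ht.le, ← Real.rpow_sub ht]
        congr 2
        push_cast
        ring

lemma wght_rpow_le {e t : ℝ} (he : e ≤ 0) (ht : 0 < t) : wght t ^ e ≤ t ^ e := by
  unfold wght
  split_ifs with h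
  · rw [Real.one_rpow]
    exact Real.one_le_rpow_of_pos_of_le_one_of_nonpos ht h.le he
  · exact le_rfl

/-- The amplitude multiplying the derivative of a primitive of `fract (b + p * f y)`. -/
def amp (α : ℝ) (n : ℕ) (x : ℝ) (f₁ : ℝ → ℝ) (y : ℝ) : ℝ := Kan α n (x / y) / (y * f₁ y)

/-- The derivative of `amp`. -/
def ampDeriv (α : ℝ) (n : ℕ) (x : ℝ) (f₁ f₂ : ℝ → ℝ) (y : ℝ) : ℝ :=
  (-(Kan α (n + 1) (x / y) / y) * (y * f₁ y) - Kan α n (x / y) * (f₁ y + y * f₂ y)) /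
    (y * f₁ y) ^ 2

section Amp

variable {α x : ℝ} {f f₁ f₂ : ℝ → ℝ}

lemma HasPosDerivs.continuousOn_amp (h : HasPosDerivs f f₁ f₂) (hα : 1 < α) (n : ℕ) :
    ContinuousOn (amp α n x f₁) (Ici 1) := by
  have h0 : ∀ y ∈ Ici (1 : ℝ), y ≠ 0 := fun y hy => by
    have : (1 : ℝ) ≤ y := hy
    positivity
  refine ContinuousOn.div ((continuous_Kan hα n).comp_continuousOn
    (continuousOn_const.div continuousOn_id h0)) (continuousOn_id.mul h.cont₁) fun y hy => ?_
  exact mul_ne_zero (h0 y hy) (h.pos y hy).ne'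

lemma HasPosDerivs.hasDerivAt_amp (h : HasPosDerivs f f₁ f₂) (hα : 1 < α) (n : ℕ)
    (hx : 0 < x) {y : ℝ} (hy : 1 < y) :
    HasDerivAt (amp α n x f₁) (ampDeriv α n x f₁ f₂ y) y := by
  have hy0 : 0 < y := by linarith
  have hp := h.pos y hy.le
  have h1 : HasDerivAt (fun y => x / y) (-(x / y ^ 2)) y := by
    refine ((hasDerivAt_inv hy0.ne').const_mul x).congr_deriv ?_ |>.congr_of_eventuallyEq ?_
    · ring
    · exact Eventually.of_forall fun z => by simp [div_eq_mul_inv]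
  have h2 := (hasDerivAt_Kan hα n (div_pos hx hy0).ne').comp y h1
  have h3 := (hasDerivAt_id y).mul (h.deriv₂ y hy)
  refine (h2.div h3 (mul_pos hy0 hp).ne').congr_deriv ?_
  simp only [ampDeriv, Function.comp, id, Pi.mul_apply, one_mul]
  congr 2
  field_simp

lemma HasPosDerivs.continuousOn_ampDeriv (h : HasPosDerivs f f₁ f₂) (hα : 1 < α) (n : ℕ) :
    ContinuousOn (ampDeriv α n x f₁ f₂) (Ici 1) := by
  have h0 : ∀ y ∈ Ici (1 : ℝ), y ≠ 0 := fun y hy => by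
    have : (1 : ℝ) ≤ y := hy
    positivity
  have hK : ∀ m, ContinuousOn (fun y => Kan α m (x / y)) (Ici 1) := fun m =>
    (continuous_Kan hα m).comp_continuousOn (continuousOn_const.div continuousOn_id h0)
  have hyf := continuousOn_id.mul h.cont₁
  refine ContinuousOn.div ?_ (hyf.pow 2) fun y hy =>
    pow_ne_zero 2 (mul_ne_zero (h0 y hy) (h.pos y hy).ne')
  exact ((((hK (n + 1)).div continuousOn_id h0).neg).mul hyf).sub
    ((hK n).mul (h.cont₁.add (continuousOn_id.mul h.cont₂)))

lemma HasPosDerivs.abs_ampDeriv_le (h : HasPosDerivs f f₁ f₂) {n : ℕ} {A : ℝ}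
    (hA₀ : ∀ u, 0 < u → |Kan α n u| ≤ A * min u (1 / u))
    (hA₁ : ∀ u, 0 < u → |Kan α (n + 1) u| ≤ A * min u (1 / u))
    (hx : 0 < x) {y : ℝ} (hy : 1 < y) :
    |ampDeriv α n x f₁ f₂ y| ≤
      f₁ y * (A * min (x / y ^ 2) (1 / x) * (2 * ((1 / f₁ y) ^ 2 / y) + |f₂ y| / f₁ y ^ 3)) := by
  have hy0 : 0 < y := by linarith
  have hp := h.pos y hy.le
  have hm : min (x / y) (1 / (x / y)) = y * min (x / y ^ 2) (1 / x) := by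
    rw [mul_min_of_nonneg _ _ hy0.le]
    congr 1 <;> field_simp
  have h0 := hA₀ (x / y) (by positivity)
  have h1 := hA₁ (x / y) (by positivity)
  rw [hm] at h0 h1
  set m := min (x / y ^ 2) (1 / x)
  set k₀ := Kan α n (x / y)
  set k₁ := Kan α (n + 1) (x / y)
  have e : ampDeriv α n x f₁ f₂ y =
      f₁ y * (-(k₁ + k₀) / y * ((1 / f₁ y) ^ 2 / y) - k₀ / y * (f₂ y / f₁ y ^ 3)) := by
    simp only [ampDeriv]
    change (-(k₁ / y) * (y * f₁ y) - k₀ * (f₁ y + y * f₂ y)) / (y * f₁ y) ^ 2 = _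
    field_simp
    ring
  rw [e, abs_mul, abs_of_pos hp]
  refine mul_le_mul_of_nonneg_left ?_ hp.le
  have b0 : |k₀ / y| ≤ A * m := by
    rw [abs_div, abs_of_pos hy0, div_le_iff₀ hy0]; linarith
  have b1 : |-(k₁ + k₀) / y| ≤ 2 * (A * m) := by
    rw [abs_div, abs_of_pos hy0, div_le_iff₀ hy0, abs_neg]
    linarith [abs_add_le k₁ k₀]
  have hq : 0 ≤ (1 / f₁ y) ^ 2 / y := by positivity
  calc _ ≤ |-(k₁ + k₀) / y * ((1 / f₁ y) ^ 2 / y)| + |k₀ / y * (f₂ y / f₁ y ^ 3)| := abs_sub _ _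
    _ = |-(k₁ + k₀) / y| * ((1 / f₁ y) ^ 2 / y) + |k₀ / y| * (|f₂ y| / f₁ y ^ 3) := by
      rw [abs_mul, abs_mul, abs_of_nonneg hq, abs_div (f₂ y), abs_of_pos (pow_pos hp 3)]
    _ ≤ 2 * (A * m) * ((1 / f₁ y) ^ 2 / y) + A * m * (|f₂ y| / f₁ y ^ 3) := by gcongr
    _ = _ := by ring

/-- The bounds on the inverse function of `f` expressed in terms of the derivatives of `f`. -/
structure InvBounds (δ N₁ N₂ g : ℝ) (f f₁ f₂ : ℝ → ℝ) : Prop where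
  nonneg₂ : 0 ≤ N₂
  pos : 0 < g
  le_one : g ≤ 1
  bound₁ : ∀ y, 1 < y → 1 / f₁ y ≤ N₁ * wght (f y) ^ (1 / δ - 1)
  bound₂ : ∀ y, 1 < y → |f₂ y| / f₁ y ^ 3 ≤ N₂ * wght (f y) ^ (1 / δ - 2)
  lower : ∀ y, 1 < y → g * f y ^ (1 / δ) ≤ y

/-- A bound for the total variation of `amp`. -/
def varBound (A δ N₁ N₂ g x : ℝ) : ℝ :=
  4 * A * (2 * N₁ ^ 2 / g + N₂) / (x * (1 / δ - 1)) * (x / g) ^ (1 - δ)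

lemma HasPosDerivs.integral_abs_ampDeriv_le {δ N₁ N₂ g A : ℝ} (h : HasPosDerivs f f₁ f₂)
    (hB : InvBounds δ N₁ N₂ g f f₁ f₂) (hα : 1 < α) (hδ : 1 / 2 < δ) (hδ' : δ < 1) {n : ℕ}
    (hA : 0 < A)
    (hA₀ : ∀ u, 0 < u → |Kan α n u| ≤ A * min u (1 / u))
    (hA₁ : ∀ u, 0 < u → |Kan α (n + 1) u| ≤ A * min u (1 / u))
    (hx : 0 < x) {Y : ℝ} (hY : 1 ≤ Y) :
    ∫ y in (1 : ℝ)..Y, |ampDeriv α n x f₁ f₂ y| ≤ varBound A δ N₁ N₂ g x := by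
  have hδ0 : 0 < δ := by linarith
  have hg := hB.pos
  have hN₂ := hB.nonneg₂
  have he : 0 < 1 / δ - 1 := by
    rw [sub_pos, lt_div_iff₀ hδ0]; linarith
  have he2 : 1 / δ - 2 ≤ 0 := by
    rw [sub_nonpos, div_le_iff₀ hδ0]; linarith
  set e := 1 / δ - 1 with he'
  set S := (x / g) ^ (1 - δ) with hS
  have hS0 : 0 < S := Real.rpow_pos_of_pos (by positivity) _
  set M := 4 * A * (2 * N₁ ^ 2 / g + N₂) / (x * e) with hM
  have hM0 : 0 ≤ M := by positivity
  have hnn : ∀ y, 1 ≤ y → 0 ≤ f y := fun y hy => by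
    rcases hy.eq_or_lt with rfl | hy
    · exact h.map_one.ge
    · exact (h.map_pos hy).le
  have hcs : ContinuousOn (fun y => f y ^ e) (Ici 1) :=
    h.cont.rpow_const fun y _ => Or.inr he.le
  have hmain := intervalIntegral.integral_le_sub_of_hasDeriv_right_of_le
    (g := fun y => M * (S * f y ^ e / (S + f y ^ e)))
    (g' := fun y => M * (S ^ 2 / (S + f y ^ e) ^ 2 * (e * f y ^ (1 / δ - 2) * f₁ y)))
    (φ := fun y => |ampDeriv α n x f₁ f₂ y|) hY ?_ ?_ ?_ ?_
  · refine hmain.trans ?_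
    have h0 : f 1 ^ e = 0 := by rw [h.map_one, Real.zero_rpow he.ne']
    have hs : 0 ≤ f Y ^ e := Real.rpow_nonneg (hnn Y hY) _
    simp only [h0, mul_zero, zero_div, sub_zero]
    change _ ≤ M * S
    refine mul_le_mul_of_nonneg_left ?_ hM0
    rw [div_le_iff₀ (by positivity)]
    nlinarith
  · refine ContinuousOn.mono ?_ Icc_subset_Ici_self
    refine continuousOn_const.mul ((continuousOn_const.mul hcs).div
      (continuousOn_const.add hcs) fun y hy => ?_)
    have := Real.rpow_nonneg (hnn y hy) e
    positivity
  · intro y hy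
    have hfy := h.map_pos hy.1
    have hs := Real.rpow_pos_of_pos hfy e
    have h1 := (h.deriv₁ y hy.1).rpow_const (p := e) (Or.inl hfy.ne')
    have h2 := ((h1.const_mul S).div (h1.const_add S) (by positivity)).const_mul M
    refine (h2.congr_deriv ?_).hasDerivWithinAt
    rw [show e - 1 = 1 / δ - 2 by rw [he']; ring]
    field_simp
    ring
  · exact (((h.continuousOn_ampDeriv hα n).mono Icc_subset_Ici_self).abs).integrableOn_Icc
  · intro y hy
    have hfy := h.map_pos hy.1
    have hs := Real.rpow_pos_of_pos hfy e
    have ht2 := Real.rpow_pos_of_pos hfy (1 / δ - 2)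
    have hp := h.pos y hy.1.le
    refine (h.abs_ampDeriv_le hA₀ hA₁ hx hy.1).trans ?_
    have b1 := min_div_sq_le hδ0 hδ' hx hg hfy (hB.lower y hy.1)
    have b2 := sq_div_le_rpow hδ hδ' hg hB.le_one hfy hy.1.le (hB.lower y hy.1)
      (by positivity) (hB.bound₁ y hy.1)
    have b3 := (hB.bound₂ y hy.1).trans
      (mul_le_mul_of_nonneg_left (wght_rpow_le he2 hfy) hN₂)
    have hm0 : 0 ≤ min (x / y ^ 2) (1 / x) := le_min (by positivity) (by positivity)
    calc _ ≤ f₁ y * (A * (4 / x * S ^ 2 / (S + f y ^ e) ^ 2) *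
          (2 * (N₁ ^ 2 / g * f y ^ (1 / δ - 2)) + N₂ * f y ^ (1 / δ - 2))) := by
          have hy0 : 0 < y := by linarith [hy.1]
          gcongr
      _ = _ := by
        rw [hM]
        field_simp

lemma HasPosDerivs.countable_fract_jump (h : HasPosDerivs f f₁ f₂) (b : ℝ) {p : ℝ} (hp : 0 < p) :
    {y : ℝ | 1 ≤ y ∧ b + p * f y - 1 / 2 ∈ Set.range ((↑) : ℤ → ℝ)}.Countable := by
  refine Set.MapsTo.countable_of_injOn (f := fun y => b + p * f y - 1 / 2)
    (fun y hy => hy.2) ?_ (Set.countable_range _)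
  intro y hy z hz hyz
  refine h.strictMonoOn.injOn hy.1 hz.1 ?_
  have : p * f y = p * f z := by simpa using hyz
  exact mul_left_cancel₀ hp.ne' this

lemma HasPosDerivs.abs_intervalIntegral_le (h : HasPosDerivs f f₁ f₂) (hα : 1 < α) (n : ℕ)
    (hx : 0 < x) (b : ℝ) {p V : ℝ} (hp : 0 < p)
    (hV : ∀ Y, 1 ≤ Y → ∫ y in (1 : ℝ)..Y, |ampDeriv α n x f₁ f₂ y| ≤ V)
    (hfi : IntegrableOn (fun y => Kan α n (x / y) * fract (b + p * f y) / y) (Ioi 1))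
    {Y : ℝ} (hY : 1 ≤ Y) :
    |∫ y in (1 : ℝ)..Y, Kan α n (x / y) * fract (b + p * f y) / y| ≤
      2 / p * (|amp α n x f₁ 1| + V) := by
  set F : ℝ → ℝ := fun y => Kan α n (x / y) * fract (b + p * f y) / y with hF
  set G := amp α n x f₁ with hG
  set G' := ampDeriv α n x f₁ f₂ with hG'
  have hsub : Icc 1 Y ⊆ Ici (1 : ℝ) := Icc_subset_Ici_self
  have hcP : ContinuousOn (fun y => fractPrim (b + p * f y)) (Ici 1) :=
    continuous_fractPrim.comp_continuousOn
      (continuousOn_const.add (continuousOn_const.mul h.cont))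
  have hcG' : ContinuousOn G' (Ici 1) := h.continuousOn_ampDeriv hα n
  have hi' : IntervalIntegrable G' volume 1 Y :=
    (hcG'.mono (by rwa [uIcc_of_le hY])).intervalIntegrable
  have hi1 : IntervalIntegrable (fun y => G' y * (fractPrim (b + p * f y) / p)) volume 1 Y :=
    ((hcG'.mul (hcP.div_const p)).mono (by rwa [uIcc_of_le hY])).intervalIntegrable
  have hi2 : IntervalIntegrable F volume 1 Y :=
    (intervalIntegrable_iff_integrableOn_Ioc_of_le hY).2 (hfi.mono_set Ioc_subset_Ioi_self)
  have hparts := integral_eq_of_hasDerivAt_off_countable_of_le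
    (fun y => G y * (fractPrim (b + p * f y) / p))
    (fun y => G' y * (fractPrim (b + p * f y) / p) + F y) hY
    (h.countable_fract_jump b hp)
    (((h.continuousOn_amp hα n).mul (hcP.div_const p)).mono hsub)
    (fun y hy => by
      have hy1 : 1 < y := hy.1.1
      have hy0 : 0 < y := by linarith
      have hfy := h.pos y hy1.le
      have hnot : b + p * f y - 1 / 2 ∉ Set.range ((↑) : ℤ → ℝ) := fun hc => hy.2 ⟨hy1.le, hc⟩
      have h1 := (hasDerivAt_fractPrim hnot).comp y
        (((h.deriv₁ y hy1).const_mul p).const_add b)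
      refine ((h.hasDerivAt_amp hα n hx hy1).mul (h1.div_const p)).congr_deriv ?_
      simp only [hF, hG', amp, Function.comp]
      field_simp)
    (hi1.add hi2)
  have hparts0 := intervalIntegral.integral_eq_sub_of_hasDerivAt_of_le hY
    ((h.continuousOn_amp (x := x) hα n).mono hsub)
    (fun y hy => h.hasDerivAt_amp hα n hx hy.1) hi'
  rw [intervalIntegral.integral_add hi1 hi2] at hparts
  have hP : ∀ s, |fractPrim s / p| ≤ 1 / p := fun s => by
    rw [abs_div, abs_of_pos hp]
    gcongr
    exact abs_fractPrim_le s
  have hI : |∫ y in (1 : ℝ)..Y, G' y * (fractPrim (b + p * f y) / p)| ≤ V / p := by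
    refine (intervalIntegral.abs_integral_le_integral_abs hY).trans ?_
    calc _ ≤ ∫ y in (1 : ℝ)..Y, |G' y| * (1 / p) := by
          refine intervalIntegral.integral_mono_on hY hi1.abs (hi'.abs.mul_const _) fun y _ => ?_
          rw [abs_mul]
          exact mul_le_mul_of_nonneg_left (hP _) (abs_nonneg _)
      _ = (∫ y in (1 : ℝ)..Y, |G' y|) / p := by
        rw [intervalIntegral.integral_mul_const]; ring
      _ ≤ V / p := by gcongr; exact hV Y hY
  have hGY : |G Y| ≤ |G 1| + V := by
    have h1 := intervalIntegral.abs_integral_le_integral_abs (f := G') (μ := volume) hY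
    have h2 := hV Y hY
    change ∫ y in (1 : ℝ)..Y, G' y = G Y - G 1 at hparts0
    rw [hparts0] at h1
    linarith [abs_sub_abs_le_abs_sub (G Y) (G 1)]
  have hV0 : 0 ≤ V := by simpa using hV 1 le_rfl
  have hB : ∀ y, |G y * (fractPrim (b + p * f y) / p)| ≤ |G y| * (1 / p) := fun y => by
    rw [abs_mul]
    exact mul_le_mul_of_nonneg_left (hP _) (abs_nonneg _)
  have hGY' : |G Y| * (1 / p) ≤ (|G 1| + V) * (1 / p) := by gcongr
  have e2 : 2 / p * (|G 1| + V) = (|G 1| + V) * (1 / p) + |G 1| * (1 / p) + V / p := by ring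
  have b1 := hB Y
  have b2 := hB 1
  rw [e2]
  rw [abs_le] at hI b1 b2 ⊢
  constructor <;> linarith [hI.1, hI.2, b1.1, b1.2, b2.1, b2.2]

lemma HasPosDerivs.abs_integral_le (h : HasPosDerivs f f₁ f₂) (hα : 1 < α) (n : ℕ)
    (hx : 0 < x) (b : ℝ) {p V : ℝ} (hp : 0 < p)
    (hV : ∀ Y, 1 ≤ Y → ∫ y in (1 : ℝ)..Y, |ampDeriv α n x f₁ f₂ y| ≤ V) :
    |∫ y in Ici (1 : ℝ), Kan α n (x / y) * fract (b + p * f y) / y| ≤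
      2 / p * (|amp α n x f₁ 1| + V) := by
  rw [integral_Ici_eq_integral_Ioi]
  by_cases hfi : IntegrableOn (fun y => Kan α n (x / y) * fract (b + p * f y) / y) (Ioi 1)
  · refine le_of_tendsto (intervalIntegral_tendsto_integral_Ioi 1 hfi tendsto_id).abs ?_
    filter_upwards [eventually_ge_atTop 1] with Y hY
    exact h.abs_intervalIntegral_le hα n hx b hp hV hfi hY
  · rw [integral_undef hfi, abs_zero]
    have hV0 : 0 ≤ V := by simpa using hV 1 le_rfl
    positivity

end Amp

lemma exists_le_of_tendsto_atTop {g : ℝ → ℝ} {l : ℝ} (hg : ContinuousOn g (Ici 1))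
    (hl : Tendsto g atTop (𝓝 l)) : ∃ B, ∀ y, 1 ≤ y → g y ≤ B := by
  obtain ⟨Y, hY⟩ := eventually_atTop.1 (hl.eventually (ge_mem_nhds (lt_add_one l)))
  obtain ⟨B, hB⟩ := isCompact_Icc.bddAbove_image (hg.mono fun z (hz : z ∈ Icc 1 Y) => hz.1)
  refine ⟨max B (l + 1), fun y hy => ?_⟩
  rcases le_total y Y with h | h
  · exact (hB (mem_image_of_mem g ⟨hy, h⟩)).trans (le_max_left _ _)
  · exact (hY y h).trans (le_max_right _ _)

lemma wght_eq_max (t : ℝ) : wght t = max 1 t := by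
  unfold wght
  split_ifs with h
  · exact (max_eq_left h.le).symm
  · exact (max_eq_right (not_lt.1 h)).symm

lemma continuous_wght : Continuous wght := by
  rw [show wght = fun t => max 1 t from funext wght_eq_max]
  fun_prop

lemma wght_pos (t : ℝ) : 0 < wght t := by
  rw [wght_eq_max]
  exact lt_max_of_lt_left one_pos

section Inverse

variable {f f₁ f₂ : ℝ → ℝ}

lemma HasPosDerivs.phiF_apply (h : HasPosDerivs f f₁ f₂) {y : ℝ} (hy : 1 ≤ y) :
    phiF f (f y) = y := by
  have : {x : ℝ | 1 ≤ x ∧ f x = f y} = {y} := by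
    ext z
    constructor
    · rintro ⟨hz, hzy⟩
      exact h.strictMonoOn.injOn hz hy hzy
    · rintro rfl
      exact ⟨hy, rfl⟩
  rw [phiF, this, csInf_singleton]

lemma HasPosDerivs.exists_eq (h : HasPosDerivs f f₁ f₂) (ht : Tendsto f atTop atTop) {t : ℝ}
    (h0 : 0 < t) : ∃ y, 1 < y ∧ f y = t := by
  obtain ⟨Y, hYt, hY1⟩ := ((ht.eventually (eventually_gt_atTop t)).and
    (eventually_ge_atTop 1)).exists
  obtain ⟨y, hy, rfl⟩ := intermediate_value_Icc hY1 (h.cont.mono Icc_subset_Ici_self)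
    (show t ∈ Icc (f 1) (f Y) from ⟨h.map_one.trans_le h0.le, hYt.le⟩)
  refine ⟨y, lt_of_le_of_ne hy.1 ?_, rfl⟩
  rintro rfl
  exact h0.ne' h.map_one

lemma HasPosDerivs.hasDerivAt_phiF (h : HasPosDerivs f f₁ f₂) (ht : Tendsto f atTop atTop)
    {y : ℝ} (hy : 1 < y) : HasDerivAt (phiF f) (f₁ y)⁻¹ (f y) := by
  have hφ := h.phiF_apply hy.le
  have hcont : ContinuousAt (phiF f) (f y) := by
    refine continuousAt_of_monotoneOn_of_image_mem_nhds (s := Ioi 0) ?_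
      (Ioi_mem_nhds (h.map_pos hy)) ?_
    · intro s hs t ht' hst
      obtain ⟨a, ha, rfl⟩ := h.exists_eq ht hs
      obtain ⟨b, hb, rfl⟩ := h.exists_eq ht ht'
      rw [h.phiF_apply ha.le, h.phiF_apply hb.le]
      exact (h.strictMonoOn.le_iff_le ha.le hb.le).1 hst
    · rw [hφ]
      refine mem_of_superset (Ioi_mem_nhds hy) fun z hz => ?_
      exact ⟨f z, h.map_pos hz, h.phiF_apply (le_of_lt hz)⟩
  refine HasDerivAt.of_local_left_inverse (f := f) hcont ?_ (h.pos y hy.le).ne' ?_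
  · rw [hφ]
    exact h.deriv₁ y hy
  · filter_upwards [Ioi_mem_nhds (h.map_pos hy)] with t h0
    obtain ⟨a, ha, rfl⟩ := h.exists_eq ht h0
    rw [h.phiF_apply ha.le]

lemma HasPosDerivs.deriv_deriv_phiF (h : HasPosDerivs f f₁ f₂) (ht : Tendsto f atTop atTop)
    {y : ℝ} (hy : 1 < y) : deriv (deriv (phiF f)) (f y) = -f₂ y / f₁ y ^ 3 := by
  have hp := h.pos y hy.le
  have hev : deriv (phiF f) =ᶠ[𝓝 (f y)] fun t => (f₁ (phiF f t))⁻¹ := by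
    filter_upwards [Ioi_mem_nhds (h.map_pos hy)] with t h0
    obtain ⟨a, ha, rfl⟩ := h.exists_eq ht h0
    rw [h.phiF_apply ha.le, (h.hasDerivAt_phiF ht ha).deriv]
  rw [hev.deriv_eq]
  have hφ := h.phiF_apply hy.le
  have h1 : HasDerivAt f₁ (f₂ y) (phiF f (f y)) := by rw [hφ]; exact h.deriv₂ y hy
  have h2 := (h1.comp (f y) (h.hasDerivAt_phiF ht hy)).inv (by simp [hφ, hp.ne'])
  refine h2.deriv.trans ?_
  simp only [Function.comp, hφ]
  field_simp

end Inverse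

section Zclass

variable {δ c : ℝ} {f : ℝ → ℝ}

/-- The derivative of `f` on `[1, ∞)`. -/
def fDer (f : ℝ → ℝ) : ℝ → ℝ := derivWithin f (Ici 1)

lemma MemZclass.hasPosDerivs (hf : MemZclass δ c f) :
    HasPosDerivs f (fDer f) (fDer (fDer f)) := by
  obtain ⟨hC, h1, hpos, -⟩ := hf
  have hU := uniqueDiffOn_Ici (1 : ℝ)
  have hC' : ContDiffOn ℝ 1 (fDer f) (Ici 1) := hC.derivWithin hU (by norm_num)
  refine ⟨h1, hC.continuousOn, hC'.continuousOn, hC'.continuousOn_derivWithin hU le_rfl, ?_, ?_,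
    hpos⟩
  · intro y hy
    exact ((hC.differentiableOn (by norm_num) y hy.le).hasDerivWithinAt).hasDerivAt (Ici_mem_nhds hy)
  · intro y hy
    exact ((hC'.differentiableOn (by norm_num) y hy.le).hasDerivWithinAt).hasDerivAt
      (Ici_mem_nhds hy)

lemma MemZclass.tendsto₀ (hf : MemZclass δ c f) :
    Tendsto (fun y => f y / y ^ δ) atTop (𝓝 c) := by
  simpa using hf.2.2.2 0 (by norm_num)

lemma MemZclass.tendsto₁ (hf : MemZclass δ c f) :
    Tendsto (fun y => y * fDer f y / y ^ δ) atTop (𝓝 (c * δ)) := by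
  simpa [eulerDW, fDer] using hf.2.2.2 1 (by norm_num)

lemma MemZclass.tendsto₂ (hf : MemZclass δ c f) :
    Tendsto (fun y => y ^ 2 * fDer (fDer f) y / y ^ δ) atTop (𝓝 (c * δ ^ 2 - c * δ)) := by
  have h := hf.hasPosDerivs
  refine ((hf.2.2.2 2 le_rfl).sub hf.tendsto₁).congr' ?_
  filter_upwards [eventually_gt_atTop 1] with y hy
  have hd : derivWithin (eulerDW (Ici 1) f) (Ici 1) y = fDer f y + y * fDer (fDer f) y := by
    have := ((hasDerivAt_id y).mul (h.deriv₂ y hy)).hasDerivWithinAt (s := Ici 1)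
    refine (this.derivWithin (uniqueDiffOn_Ici (1 : ℝ) y hy.le)).trans ?_
    simp
  have e : (eulerDW (Ici 1))^[2] f y = y * derivWithin (eulerDW (Ici 1) f) (Ici 1) y := rfl
  rw [e, hd]
  ring

lemma MemZclass.tendsto_atTop (hf : MemZclass δ c f) (hδ : 0 < δ) (hc : 0 < c) :
    Tendsto f atTop atTop := by
  refine (hf.tendsto₀.pos_mul_atTop hc (tendsto_rpow_atTop hδ)).congr' ?_
  filter_upwards [eventually_gt_atTop 0] with y hy
  have := Real.rpow_pos_of_pos hy δ
  field_simp

lemma rpow_neg_eq_div_rpow (hδ : 0 < δ) {t y : ℝ} (ht : 0 < t) (hy : 0 < y) (k : ℝ) :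
    t ^ (-(1 / δ - k)) = (t / y ^ δ) ^ (-(1 / δ - k)) * (y ^ k) ^ δ / y := by
  have hp := Real.rpow_pos_of_pos hy δ
  rw [Real.div_rpow ht.le hp.le, ← Real.rpow_mul hy.le, ← Real.rpow_mul hy.le,
    show δ * -(1 / δ - k) = k * δ - 1 by field_simp; ring, Real.rpow_sub_one hy.ne']
  have := Real.rpow_pos_of_pos hy (k * δ)
  field_simp

lemma MemZclass.bddAbove_N1c (hf : MemZclass δ c f) (hδ : 0 < δ) (hc : 0 < c) :
    BddAbove ((fun t => wght t ^ (-(1 / δ - 1)) * |deriv (phiF f) t|) '' Ioi 0) := by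
  have h := hf.hasPosDerivs
  have ht := hf.tendsto_atTop hδ hc
  have hlim : Tendsto (fun y => wght (f y) ^ (-(1 / δ - 1)) * |(fDer f y)⁻¹|) atTop
      (𝓝 (c ^ (-(1 / δ - 1)) / (c * δ))) := by
    refine ((hf.tendsto₀.rpow_const (Or.inl hc.ne')).div hf.tendsto₁ (by positivity)).congr' ?_
    filter_upwards [eventually_gt_atTop 1, ht.eventually (eventually_ge_atTop 1)] with y hy hfy
    have hy0 : 0 < y := by linarith
    have hp := h.pos y hy.le
    have hyd := Real.rpow_pos_of_pos hy0 δ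
    simp only [Pi.div_apply]
    rw [wght_eq_max, max_eq_right hfy, rpow_neg_eq_div_rpow hδ (h.map_pos hy) hy0 1,
      Real.rpow_one, abs_of_pos (inv_pos.2 hp)]
    field_simp
  obtain ⟨B, hB⟩ := exists_le_of_tendsto_atTop (((continuous_wght.comp_continuousOn
    h.cont).rpow_const fun y _ => Or.inl (wght_pos _).ne').mul
      (h.cont₁.inv₀ fun y hy => (h.pos y hy).ne').abs) hlim
  refine ⟨B, ?_⟩
  rintro _ ⟨t, h0, rfl⟩
  obtain ⟨y, hy, rfl⟩ := h.exists_eq ht h0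
  simp only [(h.hasDerivAt_phiF ht hy).deriv]
  exact hB y hy.le

lemma MemZclass.bddAbove_N2c (hf : MemZclass δ c f) (hδ : 0 < δ) (hc : 0 < c) :
    BddAbove ((fun t => wght t ^ (-(1 / δ - 2)) * |deriv (deriv (phiF f)) t|) '' Ioi 0) := by
  have h := hf.hasPosDerivs
  have ht := hf.tendsto_atTop hδ hc
  have hlim : Tendsto
      (fun y => wght (f y) ^ (-(1 / δ - 2)) * |-fDer (fDer f) y / fDer f y ^ 3|) atTop
      (𝓝 (c ^ (-(1 / δ - 2)) * |c * δ ^ 2 - c * δ| / (c * δ) ^ 3)) := by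
    refine (((hf.tendsto₀.rpow_const (Or.inl hc.ne')).mul hf.tendsto₂.abs).div
      (hf.tendsto₁.pow 3) (by positivity)).congr' ?_
    filter_upwards [eventually_gt_atTop 1, ht.eventually (eventually_ge_atTop 1)] with y hy hfy
    have hy0 : 0 < y := by linarith
    have hp := h.pos y hy.le
    have hyd := Real.rpow_pos_of_pos hy0 δ
    have e : (y ^ (2 : ℝ)) ^ δ = (y ^ δ) ^ 2 := by
      rw [← Real.rpow_mul hy0.le, mul_comm, Real.rpow_mul hy0.le, Real.rpow_two]
    simp only [Pi.div_apply]
    rw [wght_eq_max, max_eq_right hfy, rpow_neg_eq_div_rpow hδ (h.map_pos hy) hy0 2, e,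
      abs_div (-_), abs_neg, abs_of_pos (pow_pos hp 3), abs_div, abs_mul, abs_of_pos hyd,
      abs_of_pos (pow_pos hy0 2)]
    field_simp
  obtain ⟨B, hB⟩ := exists_le_of_tendsto_atTop (((continuous_wght.comp_continuousOn
    h.cont).rpow_const fun y _ => Or.inl (wght_pos _).ne').mul
      (h.cont₂.neg.div (h.cont₁.pow 3) fun y hy => (pow_pos (h.pos y hy) 3).ne').abs) hlim
  refine ⟨B, ?_⟩
  rintro _ ⟨t, h0, rfl⟩
  obtain ⟨y, hy, rfl⟩ := h.exists_eq ht h0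
  simp only [h.deriv_deriv_phiF ht hy]
  exact hB y hy.le

lemma N1c_nonneg (δ : ℝ) (f : ℝ → ℝ) : 0 ≤ N1c δ f := by
  refine Real.sSup_nonneg ?_
  rintro _ ⟨t, -, rfl⟩
  exact mul_nonneg (Real.rpow_nonneg (wght_pos t).le _) (abs_nonneg _)

lemma N2c_nonneg (δ : ℝ) (f : ℝ → ℝ) : 0 ≤ N2c δ f := by
  refine Real.sSup_nonneg ?_
  rintro _ ⟨t, -, rfl⟩
  exact mul_nonneg (Real.rpow_nonneg (wght_pos t).le _) (abs_nonneg _)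

lemma MemZclass.one_div_le_N1c (hf : MemZclass δ c f) (hδ : 0 < δ) (hc : 0 < c) {y : ℝ}
    (hy : 1 < y) : 1 / fDer f y ≤ N1c δ f * wght (f y) ^ (1 / δ - 1) := by
  have h := hf.hasPosDerivs
  have hle := le_csSup (hf.bddAbove_N1c hδ hc) (mem_image_of_mem _ (h.map_pos hy))
  simp only [(h.hasDerivAt_phiF (hf.tendsto_atTop hδ hc) hy).deriv] at hle
  rw [abs_of_pos (inv_pos.2 (h.pos y hy.le)), Real.rpow_neg (wght_pos _).le,
    inv_mul_le_iff₀ (Real.rpow_pos_of_pos (wght_pos _) _), mul_comm] at hle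
  rwa [one_div]

lemma MemZclass.abs_div_le_N2c (hf : MemZclass δ c f) (hδ : 0 < δ) (hc : 0 < c) {y : ℝ}
    (hy : 1 < y) :
    |fDer (fDer f) y| / fDer f y ^ 3 ≤ N2c δ f * wght (f y) ^ (1 / δ - 2) := by
  have h := hf.hasPosDerivs
  have hle := le_csSup (hf.bddAbove_N2c hδ hc) (mem_image_of_mem _ (h.map_pos hy))
  simp only [h.deriv_deriv_phiF (hf.tendsto_atTop hδ hc) hy] at hle
  rwa [abs_div, abs_neg, abs_of_pos (pow_pos (h.pos y hy.le) 3), Real.rpow_neg (wght_pos _).le,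
    inv_mul_le_iff₀ (Real.rpow_pos_of_pos (wght_pos _) _), mul_comm] at hle

lemma MemZclass.one_div_one_le_N1c (hf : MemZclass δ c f) (hδ : 0 < δ) (hc : 0 < c) :
    1 / fDer f 1 ≤ N1c δ f := by
  have h := hf.hasPosDerivs
  have h1 : Tendsto (fun y => 1 / fDer f y) (𝓝[>] 1) (𝓝 (1 / fDer f 1)) :=
    tendsto_const_nhds.div ((h.cont₁ 1 self_mem_Ici).mono Ioi_subset_Ici_self)
      (h.pos 1 le_rfl).ne'
  have h2 : Tendsto (fun y => N1c δ f * wght (f y) ^ (1 / δ - 1)) (𝓝[>] 1)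
      (𝓝 (N1c δ f * wght (f 1) ^ (1 / δ - 1))) :=
    ((((continuous_wght.comp_continuousOn h.cont) 1 self_mem_Ici).mono
      Ioi_subset_Ici_self).rpow_const (Or.inl (wght_pos _).ne')).const_mul _
  have hle := le_of_tendsto_of_tendsto h1 h2 <| by
    filter_upwards [self_mem_nhdsWithin] with y hy using hf.one_div_le_N1c hδ hc hy
  simpa [h.map_one, wght] using hle

lemma MemZclass.GammaC_le (hf : MemZclass δ c f) (hδ : 0 < δ) (hc : 0 < c) {y : ℝ}
    (hy : 1 < y) (hfy : 1 ≤ f y) : GammaC δ f ≤ f y ^ (-(1 / δ)) * y := by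
  have h := hf.hasPosDerivs
  have ht := hf.tendsto_atTop hδ hc
  have hb : BddBelow ((fun t => t ^ (-(1 / δ)) * phiF f t) '' Ici 1) := by
    refine ⟨0, ?_⟩
    rintro _ ⟨t, h1, rfl⟩
    obtain ⟨z, hz, rfl⟩ := h.exists_eq ht (lt_of_lt_of_le one_pos h1)
    have := Real.rpow_nonneg (h.map_pos hz).le (-(1 / δ))
    simp only [h.phiF_apply hz.le]
    positivity
  have hle := csInf_le hb (mem_image_of_mem _ hfy)
  simp only [h.phiF_apply hy.le] at hle
  exact hle

lemma MemZclass.GammaC_pos (hf : MemZclass δ c f) (hδ : 0 < δ) (hc : 0 < c) :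
    0 < GammaC δ f := by
  have h := hf.hasPosDerivs
  have ht := hf.tendsto_atTop hδ hc
  obtain ⟨B, hB⟩ := exists_le_of_tendsto_atTop (h.cont.div
    (continuousOn_id.rpow_const fun y _ => Or.inr hδ.le) fun y hy =>
      (Real.rpow_pos_of_pos (lt_of_lt_of_le one_pos hy) δ).ne') hf.tendsto₀
  have hB0 : 0 < B := lt_of_lt_of_le (div_pos (h.map_pos one_lt_two)
    (Real.rpow_pos_of_pos two_pos δ)) (hB 2 one_le_two)
  refine lt_of_lt_of_le (Real.rpow_pos_of_pos hB0 (-(1 / δ))) ?_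
  refine le_csInf (nonempty_Ici.image _) ?_
  rintro _ ⟨t, h1, rfl⟩
  obtain ⟨y, hy, rfl⟩ := h.exists_eq ht (lt_of_lt_of_le one_pos h1)
  have hy0 : 0 < y := by linarith
  have hp := Real.rpow_pos_of_pos hy0 δ
  have hfy := h.map_pos hy
  simp only [h.phiF_apply hy.le]
  have e : f y ^ (-(1 / δ)) * y = (f y / y ^ δ) ^ (-(1 / δ)) := by
    have := rpow_neg_eq_div_rpow hδ hfy hy0 0
    simp only [sub_zero, Real.rpow_zero, Real.one_rpow, mul_one] at this
    rw [this]
    field_simp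
  rw [e]
  exact Real.rpow_le_rpow_of_nonpos (by positivity) (hB y hy.le) (by simp [hδ.le])

lemma MemZclass.GammaC_le_rpow (hf : MemZclass δ c f) (hδ : 0 < δ) (hc : 0 < c) :
    GammaC δ f ≤ c ^ (-(1 / δ)) := by
  have h := hf.hasPosDerivs
  have ht := hf.tendsto_atTop hδ hc
  refine ge_of_tendsto (hf.tendsto₀.rpow_const (p := -(1 / δ)) (Or.inl hc.ne')) ?_
  filter_upwards [eventually_gt_atTop 1, ht.eventually (eventually_ge_atTop 1)] with y hy hfy
  have hy0 : 0 < y := by linarith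
  refine (hf.GammaC_le hδ hc hy hfy).trans_eq ?_
  have := rpow_neg_eq_div_rpow hδ (h.map_pos hy) hy0 0
  simp only [sub_zero, Real.rpow_zero, Real.one_rpow, mul_one] at this
  rw [this]
  field_simp

lemma MemZclass.invBounds (hf : MemZclass δ c f) (hδ : 0 < δ) (hc : 0 < c) :
    InvBounds δ (N1c δ f) (N2c δ f) (min 1 (c ^ (1 / δ)) * GammaC δ f)
      f (fDer f) (fDer (fDer f)) := by
  have h := hf.hasPosDerivs
  have hΓ := hf.GammaC_pos hδ hc
  have hcδ := Real.rpow_pos_of_pos hc (1 / δ)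
  have hκ : 0 < min 1 (c ^ (1 / δ)) := lt_min one_pos hcδ
  have hle1 : min 1 (c ^ (1 / δ)) * GammaC δ f ≤ 1 := by
    calc _ ≤ c ^ (1 / δ) * c ^ (-(1 / δ)) := by
          gcongr
          · exact min_le_right _ _
          · exact hf.GammaC_le_rpow hδ hc
      _ = 1 := by rw [← Real.rpow_add hc]; simp
  refine ⟨N2c_nonneg δ f, by positivity, hle1, fun y hy => hf.one_div_le_N1c hδ hc hy,
    fun y hy => hf.abs_div_le_N2c hδ hc hy, fun y hy => ?_⟩
  have hfy := h.map_pos hy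
  rcases le_total 1 (f y) with h1 | h1
  · have hle := hf.GammaC_le hδ hc hy h1
    rw [Real.rpow_neg hfy.le, le_inv_mul_iff₀ (Real.rpow_pos_of_pos hfy _)] at hle
    have hpos := Real.rpow_pos_of_pos hfy (1 / δ)
    calc _ ≤ 1 * GammaC δ f * f y ^ (1 / δ) := by
          gcongr
          exact min_le_left _ _
      _ ≤ y := by linarith
  · calc _ ≤ (1 : ℝ) * 1 :=
          mul_le_mul hle1 (Real.rpow_le_one hfy.le h1 (by positivity))
            (Real.rpow_nonneg hfy.le _) zero_le_one
      _ ≤ y := by linarith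

end Zclass

lemma varBound_le {A δ N₁ N₂ κ Γ x : ℝ} (hA : 0 < A) (hδ : 0 < δ) (hδ' : δ < 1)
    (hN₂ : 0 ≤ N₂) (hκ : 0 < κ) (hκ1 : κ ≤ 1) (hΓ : 0 < Γ) (hκΓ : κ * Γ ≤ 1) (hx : 0 < x) :
    varBound A δ N₁ N₂ (κ * Γ) x ≤
      8 * A / ((1 / δ - 1) * κ ^ 2) / x ^ δ * ((N₁ / Γ) ^ 2 + N₂ / Γ) := by
  have he : 0 < 1 / δ - 1 := by
    rw [sub_pos, lt_div_iff₀ hδ]; linarith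
  have hg : 0 < κ * Γ := by positivity
  have hxδ := Real.rpow_pos_of_pos hx δ
  have hr : (x / (κ * Γ)) ^ (1 - δ) ≤ x / x ^ δ / (κ * Γ) := by
    rw [Real.div_rpow hx.le hg.le, Real.rpow_sub hx, Real.rpow_one]
    gcongr
    calc κ * Γ = (κ * Γ) ^ (1 : ℝ) := (Real.rpow_one _).symm
      _ ≤ _ := Real.rpow_le_rpow_of_exponent_ge hg hκΓ (by linarith)
  calc varBound A δ N₁ N₂ (κ * Γ) x
      ≤ 4 * A * (2 * N₁ ^ 2 / (κ * Γ) + N₂) / (x * (1 / δ - 1)) * (x / x ^ δ / (κ * Γ)) := by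
        unfold varBound
        gcongr
    _ = 4 * A / ((1 / δ - 1) * κ ^ 2) / x ^ δ * (2 * (N₁ / Γ) ^ 2 + κ * (N₂ / Γ)) := by
        generalize 1 / δ - 1 = e at he
        field_simp
    _ ≤ 4 * A / ((1 / δ - 1) * κ ^ 2) / x ^ δ * (2 * (N₁ / Γ) ^ 2 + 2 * (N₂ / Γ)) := by
        gcongr
        linarith
    _ = _ := by ring

theorem statement17 (α δ c p₀ : ℝ) (n : ℕ) (hα : 1 < α)
    (hδ : 1/2 < δ) (hδ' : δ < 1) (hc : 0 < c) (hp₀ : 0 < p₀) :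
    ∃ C : ℝ, 0 < C ∧
      ∀ f : ℝ → ℝ, MemZclass δ c f → ∀ p : ℝ, p₀ ≤ p → ∀ b : ℝ, ∀ x : ℝ, 1 ≤ x →
        |∫ y in Set.Ici (1:ℝ), Kan α n (x / y) * fract (b + p * f y) / y| ≤
          C / (c * p * x ^ δ) *
            (N1c δ f + (N1c δ f / GammaC δ f) ^ 2 + N2c δ f / GammaC δ f) := by
  have hδ0 : 0 < δ := by linarith
  obtain ⟨A₀, hA₀, hb₀⟩ := exists_abs_Kan_le hα n
  obtain ⟨A₁, hA₁, hb₁⟩ := exists_abs_Kan_le hα (n + 1)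
  set A := max A₀ A₁
  have hA : 0 < A := lt_max_of_lt_left hA₀
  have hm : ∀ u : ℝ, 0 < u → 0 ≤ min u (1 / u) := fun u hu => le_min hu.le (by positivity)
  have hK₀ : ∀ u, 0 < u → |Kan α n u| ≤ A * min u (1 / u) := fun u hu =>
    (hb₀ u hu).trans (mul_le_mul_of_nonneg_right (le_max_left _ _) (hm u hu))
  have hK₁ : ∀ u, 0 < u → |Kan α (n + 1) u| ≤ A * min u (1 / u) := fun u hu =>
    (hb₁ u hu).trans (mul_le_mul_of_nonneg_right (le_max_right _ _) (hm u hu))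
  have he : 0 < 1 / δ - 1 := by
    rw [sub_pos, lt_div_iff₀ hδ0]; linarith
  have hκ : 0 < min 1 (c ^ (1 / δ)) := lt_min one_pos (Real.rpow_pos_of_pos hc _)
  set E := 8 * A / ((1 / δ - 1) * min 1 (c ^ (1 / δ)) ^ 2) with hE
  have hE0 : 0 < E := by positivity
  refine ⟨2 * c * (A + E), by positivity, fun f hf p hp b x hx => ?_⟩
  have hp0 : 0 < p := by linarith
  have hx0 : 0 < x := by linarith
  have hxδ := Real.rpow_pos_of_pos hx0 δ
  have h := hf.hasPosDerivs
  have hB := hf.invBounds hδ0 hc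
  have hΓ := hf.GammaC_pos hδ0 hc
  have hN₁ := N1c_nonneg δ f
  have hN₂ := N2c_nonneg δ f
  refine (h.abs_integral_le hα n hx0 b hp0 fun Y hY =>
    h.integral_abs_ampDeriv_le hB hα hδ hδ' hA hK₀ hK₁ hx0 hY).trans ?_
  have hamp : |amp α n x (fDer f) 1| ≤ A / x ^ δ * N1c δ f := by
    rw [amp, div_one, one_mul, abs_div, abs_of_pos (h.pos 1 le_rfl), div_eq_mul_one_div]
    have hxx : min x (1 / x) ≤ 1 / x ^ δ := (min_le_right _ _).trans <|
      one_div_le_one_div_of_le hxδ <| by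
        simpa using Real.rpow_le_rpow_of_exponent_le hx hδ'.le
    have hk : |Kan α n x| ≤ A / x ^ δ := by
      rw [div_eq_mul_one_div]
      exact (hK₀ x hx0).trans (mul_le_mul_of_nonneg_left hxx hA.le)
    exact mul_le_mul hk (hf.one_div_one_le_N1c hδ0 hc) (one_div_nonneg.2 (h.pos 1 le_rfl).le)
      (by positivity)
  have hvar := varBound_le (N₁ := N1c δ f) hA hδ0 hδ' hN₂ hκ (min_le_left _ _) hΓ hB.le_one hx0
  rw [← hE] at hvar
  have hR : 0 ≤ (N1c δ f / GammaC δ f) ^ 2 + N2c δ f / GammaC δ f := by positivity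
  set R := (N1c δ f / GammaC δ f) ^ 2 + N2c δ f / GammaC δ f
  calc _ ≤ 2 / p * (A / x ^ δ * N1c δ f + E / x ^ δ * R) := by gcongr
    _ ≤ 2 / p * ((A + E) / x ^ δ * N1c δ f + (A + E) / x ^ δ * R) := by
      gcongr <;> linarith
    _ = 2 * c * (A + E) / (c * p * x ^ δ) * (N1c δ f + R) := by field_simp
    _ = _ := by rw [add_assoc (N1c δ f)]
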